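/- arXiv:1305.6691 — 2 statements merged into one kernel-verified Lean document; each statement's English description precedes it below -/
import Mathlib

section
/- Let X be a real Banach space and let A, B : X ⇉ X* be maximally monotone operators with int(dom A) ∩ int(dom B) ≠ ∅. Then A + B is maximally monotone. -/
open Set Filter Topology

noncomputable section

variable {X : Type*} [NormedAddCommGroup X] [NormedSpace ℝ X]

/-- A set-valued operator `A : X ⇉ X*`, identified with its graph,
is monotone if `⟨x − y, x* − y*⟩ ≥ 0` for all `(x, x*), (y, y*)` in the graph. -/
def IsMonotoneOp (A : Set (X × (X →L[ℝ] ℝ))) : Prop :=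
  ∀ p ∈ A, ∀ q ∈ A, 0 ≤ (p.2 - q.2) (p.1 - q.1)

/-- `A` is maximally monotone if it is monotone and its graph is not properly contained
in the graph of any monotone operator. -/
def IsMaxMonotoneOp (A : Set (X × (X →L[ℝ] ℝ))) : Prop :=
  IsMonotoneOp A ∧ ∀ B : Set (X × (X →L[ℝ] ℝ)), IsMonotoneOp B → A ⊆ B → B = A

/-- The domain of a set-valued operator. -/
def opDom (A : Set (X × (X →L[ℝ] ℝ))) : Set X :=
  {x | ∃ xs, (x, xs) ∈ A}

/-- `(z, z*)` is monotonically related to `S` if `⟨z − y, z* − y*⟩ ≥ 0` for all `(y, y*) ∈ S`. -/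
def MonotonicallyRelated (S : Set (X × (X →L[ℝ] ℝ))) (p : X × (X →L[ℝ] ℝ)) : Prop :=
  ∀ q ∈ S, 0 ≤ (p.2 - q.2) (p.1 - q.1)

/-- A maximally monotone operator `A` is of type (FPV) if for every open convex set `U`
meeting `dom A`, every `(x, x*)` with `x ∈ U` monotonically related to
`gra A ∩ (U × X*)` belongs to `gra A`. -/
def IsFPV (A : Set (X × (X →L[ℝ] ℝ))) : Prop :=
  IsMaxMonotoneOp A ∧
    ∀ U : Set X, IsOpen U → Convex ℝ U → (U ∩ opDom A).Nonempty →
      ∀ x : X, ∀ xs : X →L[ℝ] ℝ, x ∈ U →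
        MonotonicallyRelated (A ∩ (U ×ˢ (univ : Set (X →L[ℝ] ℝ)))) (x, xs) →
        (x, xs) ∈ A

/-- The graph of the sum `A + B`: `(A + B)x = {a* + b* : a* ∈ A x, b* ∈ B x}`. -/
def opSum (A B : Set (X × (X →L[ℝ] ℝ))) : Set (X × (X →L[ℝ] ℝ)) :=
  {p | ∃ as bs, (p.1, as) ∈ A ∧ (p.1, bs) ∈ B ∧ p.2 = as + bs}

/-- The star (centre) of a set `C`: points `x ∈ C` with `[x, c] ⊆ C` for all `c ∈ C`. -/
def starSet (C : Set X) : Set X :=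
  {x ∈ C | ∀ c ∈ C, segment ℝ x c ⊆ C}

/-- The Fitzpatrick function of `A`:
`F_A(x, x*) = sup_{(a, a*) ∈ gra A} (⟨x, a*⟩ + ⟨a, x*⟩ − ⟨a, a*⟩)`, with values in `(−∞, +∞]`. -/
def fitz (A : Set (X × (X →L[ℝ] ℝ))) (p : X × (X →L[ℝ] ℝ)) : EReal :=
  ⨆ q ∈ A, ((q.2 p.1 + p.2 q.1 - q.2 q.1 : ℝ) : EReal)



theorem max_mem {A : Set (X × (X →L[ℝ] ℝ))} (hA : IsMaxMonotoneOp A) {x : X} {xs : X →L[ℝ] ℝ}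
    (h : ∀ y ys, (y, ys) ∈ A → 0 ≤ (xs - ys) (x - y)) : (x, xs) ∈ A := by
  have hmon : IsMonotoneOp (insert (x, xs) A) := by
    intro p hp q hq
    rcases hp with rfl | hp <;> rcases hq with rfl | hq
    · simp
    · exact h q.1 q.2 hq
    · have := h p.1 p.2 hp
      simp only [_root_.sub_apply, map_sub] at this ⊢
      linarith
    · exact hA.1 p hp q hq
  have := hA.2 _ hmon (subset_insert _ _)
  rw [← this]
  exact mem_insert _ _

theorem mono_ineq {A : Set (X × (X →L[ℝ] ℝ))} (hA : IsMonotoneOp A) {x y : X}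
    {xs ys : X →L[ℝ] ℝ} (hx : (x, xs) ∈ A) (hy : (y, ys) ∈ A) :
    0 ≤ xs x - xs y - ys x + ys y := by
  have := hA _ hx _ hy
  simp only [_root_.sub_apply, map_sub] at this
  linarith

theorem max_mem' {A : Set (X × (X →L[ℝ] ℝ))} (hA : IsMaxMonotoneOp A) {x : X} {xs : X →L[ℝ] ℝ}
    (h : ∀ y ys, (y, ys) ∈ A → 0 ≤ xs x - xs y - ys x + ys y) : (x, xs) ∈ A := by
  apply max_mem hA
  intro y ys hy
  have := h y ys hy
  simp only [_root_.sub_apply, map_sub]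
  linarith

theorem pointwise_bdd [CompleteSpace X] {ι : Type*} (g : ι → X →L[ℝ] ℝ) {r : ℝ} (hr : 0 < r)
    (h : ∀ u : X, ‖u‖ < r → ∃ C, ∀ i, g i u ≤ C) : ∃ K, ∀ i, ‖g i‖ ≤ K := by
  apply banach_steinhaus
  intro x
  set c : ℝ := r / (‖x‖ + 1) with hc
  have hx : 0 < ‖x‖ + 1 := by positivity
  have hc0 : 0 < c := by positivity
  have hcx : ‖c • x‖ < r := by
    rw [norm_smul, Real.norm_of_nonneg hc0.le, hc, div_mul_eq_mul_div, div_lt_iff₀ hx]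
    nlinarith [norm_nonneg x]
  obtain ⟨C1, h1⟩ := h (c • x) hcx
  obtain ⟨C2, h2⟩ := h (-(c • x)) (by rwa [norm_neg])
  refine ⟨max C1 C2 / c, fun i => ?_⟩
  rw [le_div_iff₀ hc0, Real.norm_eq_abs]
  have e1 := h1 i
  have e2 := h2 i
  simp only [map_neg, map_smul, smul_eq_mul] at e1 e2
  have : |g i x| * c = |c * g i x| := by rw [abs_mul, abs_of_pos hc0, mul_comm]
  rw [this, abs_le]
  constructor
  · linarith [le_max_right C1 C2]
  · linarith [le_max_left C1 C2]

theorem locally_bdd [CompleteSpace X] {A : Set (X × (X →L[ℝ] ℝ))} (hA : IsMonotoneOp A) {x : X}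
    (hx : x ∈ interior (opDom A)) :
    ∃ ε > 0, ∃ M : ℝ, ∀ y, ‖y - x‖ < ε → ∃ ys, (y, ys) ∈ A ∧ ‖ys‖ ≤ M := by
  rw [mem_interior_iff_mem_nhds, Metric.mem_nhds_iff] at hx
  obtain ⟨r, hr, hball⟩ := hx
  have hdom : ∀ u : X, ‖u‖ < r → ∃ us, (x + u, us) ∈ A := by
    intro u hu
    apply hball
    simpa [Metric.mem_ball, dist_eq_norm] using hu
  let ι := {p : X × (X →L[ℝ] ℝ) // p ∈ A ∧ ‖p.1 - x‖ < 1}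
  let g : ι → X →L[ℝ] ℝ := fun i => (1 + ‖i.1.1 - x‖ * ‖i.1.2‖)⁻¹ • i.1.2
  have hpb : ∃ K, ∀ i, ‖g i‖ ≤ K := by
    apply pointwise_bdd g hr
    intro u hu
    obtain ⟨us, hus⟩ := hdom u hu
    refine ⟨1 + (1 + ‖u‖) * ‖us‖, ?_⟩
    rintro ⟨⟨y, ys⟩, hy, hy1⟩
    simp only [g, _root_.smul_apply, smul_eq_mul]
    simp only at hy1
    have hpos : 0 < 1 + ‖y - x‖ * ‖ys‖ := by positivity
    rw [inv_mul_le_iff₀ hpos]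
    have hm := mono_ineq hA hy hus
    have h1 : ys (y - x) ≤ ‖y - x‖ * ‖ys‖ := by
      have := (le_abs_self _).trans (ys.le_opNorm (y - x))
      linarith [mul_comm ‖ys‖ ‖y - x‖]
    have h2 : us (x + u - y) ≤ ‖us‖ * (1 + ‖u‖) := by
      refine ((le_abs_self _).trans (us.le_opNorm _)).trans ?_
      gcongr
      calc ‖x + u - y‖ = ‖u - (y - x)‖ := by congr 1; abel
        _ ≤ ‖u‖ + ‖y - x‖ := norm_sub_le _ _
        _ ≤ 1 + ‖u‖ := by linarith
    simp only [map_add, map_sub] at hm h1 h2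
    have h3 : 0 ≤ (‖y - x‖ * ‖ys‖) * ((1 + ‖u‖) * ‖us‖) := by positivity
    nlinarith
  obtain ⟨K, hK⟩ := hpb
  have hK0 : 0 ≤ |K| := abs_nonneg K
  refine ⟨min r (min 1 (1 / (2 * |K| + 1))), by positivity, 2 * |K|, ?_⟩
  intro y hy
  have hy1 : ‖y - x‖ < r := hy.trans_le (min_le_left _ _)
  have hy2 : ‖y - x‖ < 1 := hy.trans_le ((min_le_right _ _).trans (min_le_left _ _))
  have hy3 : ‖y - x‖ < 1 / (2 * |K| + 1) := hy.trans_le ((min_le_right _ _).trans (min_le_right _ _))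
  obtain ⟨ys, hys⟩ := hdom (y - x) hy1
  rw [add_sub_cancel] at hys
  refine ⟨ys, hys, ?_⟩
  have := hK ⟨(y, ys), hys, hy2⟩
  simp only [g, norm_smul, norm_inv] at this
  have hpos : 0 < 1 + ‖y - x‖ * ‖ys‖ := by positivity
  rw [Real.norm_of_nonneg hpos.le, inv_mul_le_iff₀ hpos] at this
  have h4 : (1 + ‖y - x‖ * ‖ys‖) * K ≤ (1 + ‖y - x‖ * ‖ys‖) * |K| :=
    mul_le_mul_of_nonneg_left (le_abs_self K) hpos.le
  rw [lt_div_iff₀ (by positivity)] at hy3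
  have h5 : ‖y - x‖ * (2 * |K| + 1) * ‖ys‖ ≤ 1 * ‖ys‖ := by gcongr
  have h6 : 0 ≤ ‖y - x‖ * ‖ys‖ := by positivity
  nlinarith

theorem hb_lemma {D : Set (X × ℝ)} (hD : Convex ℝ D) {u0 : X} {ε M : ℝ} (hε : 0 < ε)
    (hopen : ∀ u, ‖u - u0‖ < ε → ∀ s, M < s → (u, s) ∈ D)
    (h0 : (0 : X) ∈ interior (Prod.fst '' D)) (hpos : ∀ s, ((0 : X), s) ∈ D → 0 ≤ s) :
    ∃ g : X →L[ℝ] ℝ, ∀ u s, (u, s) ∈ D → g u ≤ s := by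
  have hint : ∀ s, M < s → (u0, s) ∈ interior D := by
    intro s hs
    have hO : IsOpen (Metric.ball u0 ε ×ˢ Ioi M) := Metric.isOpen_ball.prod isOpen_Ioi
    have hsub : Metric.ball u0 ε ×ˢ Ioi M ⊆ D := by
      rintro ⟨u, t⟩ ⟨hu, ht⟩
      exact hopen u (by simpa [dist_eq_norm] using hu) t ht
    exact interior_maximal hsub hO ⟨Metric.mem_ball_self hε, hs⟩
  have hnot : ((0 : X), (0 : ℝ)) ∉ interior D := by
    intro h
    have hc : Tendsto (fun n : ℝ => ((0 : X), n)) (𝓝 0) (𝓝 ((0 : X), (0 : ℝ))) :=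
      (Continuous.prodMk_right (0 : X)).tendsto 0
    have h2 : ∀ᶠ n : ℝ in 𝓝 0, ((0 : X), n) ∈ D :=
      hc.eventually (mem_interior_iff_mem_nhds.1 h)
    obtain ⟨δ, hδ, hb⟩ := Metric.eventually_nhds_iff.1 h2
    have := hpos (-(δ / 2)) (hb (by simp [abs_of_pos hδ]; linarith))
    linarith
  obtain ⟨f, hf⟩ := geometric_hahn_banach_point_open hD.interior isOpen_interior hnot
  have hf0 : f ((0 : X), (0 : ℝ)) = 0 := map_zero f
  rw [hf0] at hf
  have hne : (interior D).Nonempty := ⟨_, hint (M + 1) (by linarith)⟩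
  have hfD : ∀ d ∈ D, 0 ≤ f d := by
    intro d hd
    have h1 : d ∈ closure (interior D) := by
      rw [hD.closure_interior_eq_closure_of_nonempty_interior hne]
      exact subset_closure hd
    have h2 : closure (interior D) ⊆ {d | 0 ≤ f d} :=
      closure_minimal (fun d hd => (hf d hd).le) (isClosed_le continuous_const f.continuous)
    exact h2 h1
  set c : ℝ := f (0, 1) with hcdef
  set g : X →L[ℝ] ℝ := f.comp (ContinuousLinearMap.inl ℝ X ℝ) with hgdef
  have hsplit : ∀ u s, f (u, s) = g u + s * c := by
    intro u s
    have : ((u, s) : X × ℝ) = (u, 0) + s • ((0 : X), (1 : ℝ)) := by simp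
    rw [this, map_add, map_smul]
    simp [g, c]
  have hc0 : 0 ≤ c := by
    by_contra hneg
    push Not at hneg
    have h1 := hfD _ (interior_subset (hint (max (M + 1) ((g u0 + 1) / (-c)))
      (lt_of_lt_of_le (by linarith) (le_max_left _ _))))
    rw [hsplit] at h1
    have h2 := le_max_right (M + 1) ((g u0 + 1) / (-c))
    rw [div_le_iff₀ (by linarith)] at h2
    linarith
  have hcpos : 0 < c := by
    rcases hc0.lt_or_eq with h | h
    · exact h
    · exfalso
      have hg : ∀ᶠ u in 𝓝 (0 : X), 0 ≤ g u := by
        filter_upwards [mem_interior_iff_mem_nhds.1 h0] with u hu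
        obtain ⟨⟨u', s⟩, hd, rfl⟩ := hu
        have := hfD _ hd
        rw [hsplit, ← h] at this
        simpa using this
      have hpos' := hf _ (hint (M + 1) (by linarith))
      rw [hsplit, ← h] at hpos'
      simp only [mul_zero, add_zero] at hpos'
      have ht : Tendsto (fun t : ℝ => (-t) • u0) (𝓝 0) (𝓝 (0 : X)) := by
        have : Continuous (fun t : ℝ => (-t) • u0) := by fun_prop
        simpa using this.tendsto 0
      obtain ⟨δ, hδ, hb⟩ := Metric.eventually_nhds_iff.1 (ht.eventually hg)
      have := hb (y := δ / 2) (by simp [abs_of_pos hδ]; linarith)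
      simp only [map_smul, smul_eq_mul] at this
      nlinarith
  refine ⟨-(c⁻¹) • g, fun u s hd => ?_⟩
  have h1 := hfD _ hd
  rw [hsplit] at h1
  simp only [_root_.smul_apply, smul_eq_mul]
  have : -c⁻¹ * g u = (-(g u)) / c := by field_simp
  rw [this, div_le_iff₀ hcpos]
  linarith

/-- The (non convex) epigraph attached to an operator. -/
def epiOp (A : Set (X × (X →L[ℝ] ℝ))) : Set (X × ℝ) :=
  {e | ∃ ys, (e.1, ys) ∈ A ∧ ys e.1 ≤ e.2}

theorem epi_ineq {A : Set (X × (X →L[ℝ] ℝ))} (hA : IsMonotoneOp A) {p : X × ℝ}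
    (hp : p ∈ convexHull ℝ (epiOp A)) :
    ∃ v : X →L[ℝ] ℝ, ∀ y a, (y, a) ∈ A → v y + a p.1 - a y ≤ p.2 := by
  have hsub : convexHull ℝ (epiOp A) ⊆
      {p | ∃ v : X →L[ℝ] ℝ, ∀ y a, (y, a) ∈ A → v y + a p.1 - a y ≤ p.2} := by
    apply convexHull_min
    · rintro ⟨y0, s⟩ ⟨ys, hy, hs⟩
      refine ⟨ys, fun y a hya => ?_⟩
      have := mono_ineq hA hy hya
      simp only at hs ⊢
      linarith
    · rintro p ⟨v, hv⟩ q ⟨w, hw⟩ a b ha hb hab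
      refine ⟨a • v + b • w, fun y c hyc => ?_⟩
      have e1 := mul_le_mul_of_nonneg_left (hv y c hyc) ha
      have e2 := mul_le_mul_of_nonneg_left (hw y c hyc) hb
      simp only [_root_.add_apply, _root_.smul_apply, smul_eq_mul,
        Prod.fst_add, Prod.smul_fst, Prod.snd_add, Prod.smul_snd, map_add, map_smul]
      have : c y = a * c y + b * c y := by rw [← add_mul, hab, one_mul]
      rw [this]
      linarith
  exact hsub hp

theorem fst_epi (A : Set (X × (X →L[ℝ] ℝ))) :
    Prod.fst '' convexHull ℝ (epiOp A) = convexHull ℝ (opDom A) := by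
  have h := (LinearMap.fst ℝ X ℝ).image_convexHull (epiOp A)
  have h2 : Prod.fst '' epiOp A = opDom A := by
    ext x
    constructor
    · rintro ⟨⟨y, s⟩, ⟨ys, hy, -⟩, rfl⟩
      exact ⟨ys, hy⟩
    · rintro ⟨xs, hx⟩
      exact ⟨(x, xs x), ⟨xs, hx, le_rfl⟩, rfl⟩
  rw [← h2]
  exact h

theorem epi_open [CompleteSpace X] {A : Set (X × (X →L[ℝ] ℝ))} (hA : IsMonotoneOp A) {x : X}
    (hx : x ∈ interior (opDom A)) :
    ∃ ε > 0, ∃ M : ℝ, ∀ u, ‖u - x‖ < ε → ∀ s, M < s → (u, s) ∈ epiOp A := by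
  obtain ⟨ε, hε, M, h⟩ := locally_bdd hA hx
  refine ⟨ε, hε, |M| * (‖x‖ + ε), fun u hu s hs => ?_⟩
  obtain ⟨us, hus, hM⟩ := h u hu
  refine ⟨us, hus, ?_⟩
  refine (le_trans ((le_abs_self _).trans (us.le_opNorm u)) ?_).trans hs.le
  have : ‖u‖ ≤ ‖x‖ + ε := by
    have := norm_add_le x (u - x)
    rw [add_sub_cancel] at this
    linarith
  have h2 := le_abs_self M
  gcongr
  exact hM.trans h2

theorem zero_mem_dom [CompleteSpace X] {A : Set (X × (X →L[ℝ] ℝ))} (hA : IsMaxMonotoneOp A)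
    (hne : (interior (opDom A)).Nonempty) (h0 : (0 : X) ∈ interior (convexHull ℝ (opDom A))) :
    (0 : X) ∈ opDom A := by
  obtain ⟨x, hx⟩ := hne
  obtain ⟨ε, hε, M, hM⟩ := epi_open hA.1 hx
  obtain ⟨g, hg⟩ := hb_lemma (convex_convexHull ℝ (epiOp A)) hε
    (fun u hu s hs => subset_convexHull ℝ _ (hM u hu s hs)) (by rwa [fst_epi]) (by
      intro s hs
      obtain ⟨v, hv⟩ := epi_ineq hA.1 hs
      by_contra hneg
      push Not at hneg
      have hmem : ((0 : X), v) ∈ A := by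
        apply max_mem' hA
        intro y ys hy
        have := hv y ys hy
        simp only [map_zero] at this ⊢
        linarith
      have := hv _ _ hmem
      simp at this
      linarith)
  refine ⟨g, max_mem' hA fun y ys hy => ?_⟩
  have := hg y (ys y) (subset_convexHull ℝ _ ⟨ys, hy, le_rfl⟩)
  simp only [map_zero]
  linarith

/-- Translate of an operator. -/
def shiftOp (A : Set (X × (X →L[ℝ] ℝ))) (z : X) (c : X →L[ℝ] ℝ) : Set (X × (X →L[ℝ] ℝ)) :=
  {p | (p.1 + z, p.2 + c) ∈ A}

theorem shift_max {A : Set (X × (X →L[ℝ] ℝ))} (hA : IsMaxMonotoneOp A) (z : X) (c : X →L[ℝ] ℝ) :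
    IsMaxMonotoneOp (shiftOp A z c) := by
  constructor
  · intro p hp q hq
    have := hA.1 _ hp _ hq
    simpa using this
  · intro B hB hsub
    apply subset_antisymm _ hsub
    rintro ⟨x, xs⟩ hx
    show (x + z, xs + c) ∈ A
    apply max_mem hA
    intro y ys hy
    have hmem : (y - z, ys - c) ∈ B := hsub (by simpa [shiftOp] using hy)
    have := hB _ hx _ hmem
    have e1 : x + z - y = x - (y - z) := by abel
    have e2 : xs + c - ys = xs - (ys - c) := by abel
    rw [e1, e2]
    exact this

theorem shift_dom (A : Set (X × (X →L[ℝ] ℝ))) (z : X) (c : X →L[ℝ] ℝ) :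
    opDom (shiftOp A z c) = (fun x => x + z) ⁻¹' opDom A := by
  ext x
  constructor
  · rintro ⟨xs, hx⟩
    exact ⟨_, hx⟩
  · rintro ⟨xs, hx⟩
    exact ⟨xs - c, by simpa [shiftOp] using hx⟩

theorem shift_int (A : Set (X × (X →L[ℝ] ℝ))) (z : X) (c : X →L[ℝ] ℝ) :
    interior (opDom (shiftOp A z c)) = (fun x => x + z) ⁻¹' interior (opDom A) := by
  rw [shift_dom]
  exact ((Homeomorph.addRight z).preimage_interior _).symm

theorem shift_conv (A : Set (X × (X →L[ℝ] ℝ))) (z : X) (c : X →L[ℝ] ℝ) :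
    (fun x => x + z) ⁻¹' interior (convexHull ℝ (opDom A)) ⊆
      interior (convexHull ℝ (opDom (shiftOp A z c))) := by
  have h1 := (Homeomorph.addRight z).preimage_interior (convexHull ℝ (opDom A))
  change (fun x => x + z) ⁻¹' interior _ = interior ((fun x => x + z) ⁻¹' _) at h1
  rw [h1]
  apply interior_mono
  have h2 : convexHull ℝ (opDom A) ⊆
      (fun x => x - z) ⁻¹' (convexHull ℝ (opDom (shiftOp A z c))) := by
    apply convexHull_min
    · intro x hx
      apply subset_convexHull
      rw [shift_dom]
      simpa using hx
    · have := (convex_convexHull ℝ (opDom (shiftOp A z c))).translate_preimage_left (-z)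
      simpa [sub_eq_add_neg] using this
  intro x hx
  simpa using h2 hx

theorem conv_int_subset [CompleteSpace X] {A : Set (X × (X →L[ℝ] ℝ))} (hA : IsMaxMonotoneOp A)
    (hne : (interior (opDom A)).Nonempty) :
    interior (convexHull ℝ (opDom A)) ⊆ opDom A := by
  intro z hz
  have h1 : (0 : X) ∈ opDom (shiftOp A z 0) := by
    apply zero_mem_dom (shift_max hA z 0)
    · obtain ⟨x, hx⟩ := hne
      refine ⟨x - z, ?_⟩
      rw [shift_int]
      simpa using hx
    · apply shift_conv
      simpa using hz
  rw [shift_dom] at h1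
  simpa using h1

theorem lim_dom [CompleteSpace X] {A : Set (X × (X →L[ℝ] ℝ))} (hA : IsMaxMonotoneOp A) {w : X}
    (hw : w ∈ interior (opDom A)) {t : ℕ → ℝ} {t0 : ℝ} (ht : Tendsto t atTop (𝓝 t0))
    (ht1 : ∀ n, t n ∈ Ioo (0 : ℝ) 1) {a : ℕ → X →L[ℝ] ℝ} (ha : ∀ n, (t n • w, a n) ∈ A) {K : ℝ}
    (hK : ∀ n, -K ≤ a n w) : t0 • w ∈ opDom A := by
  rw [mem_interior_iff_mem_nhds, Metric.mem_nhds_iff] at hw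
  obtain ⟨r, hr, hball⟩ := hw
  obtain ⟨M, hM⟩ : ∃ M, ∀ n, ‖a n‖ ≤ M := by
    apply pointwise_bdd a hr
    intro u hu
    obtain ⟨us, hus⟩ : w + u ∈ opDom A := by
      apply hball
      simpa [Metric.mem_ball, dist_eq_norm] using hu
    refine ⟨|K| + us (w + u) + |us w|, fun n => ?_⟩
    have hm := mono_ineq hA.1 (ha n) hus
    obtain ⟨h0, h1⟩ := ht1 n
    have hKn := hK n
    simp only [map_add, map_smul, smul_eq_mul] at hm ⊢
    have e1 : (1 - t n) * (- a n w) ≤ |K| := by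
      have : (1 - t n) * (- a n w) ≤ (1 - t n) * |K| :=
        mul_le_mul_of_nonneg_left (by linarith [le_abs_self K]) (by linarith)
      nlinarith [abs_nonneg K]
    have e2 : - (t n * us w) ≤ |us w| := by
      have : t n * (- us w) ≤ t n * |us w| :=
        mul_le_mul_of_nonneg_left (neg_le_abs _) h0.le
      nlinarith [abs_nonneg (us w)]
    linarith
  let f : ℕ → WeakDual ℝ X := fun n => StrongDual.toWeakDual (a n)
  have hc := WeakDual.isCompact_closedBall (𝕜 := ℝ) (0 : StrongDual ℝ X) M
  obtain ⟨b, -, hb⟩ := isCompact_iff_ultrafilter_le_nhds.1 hc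
    (Ultrafilter.map f (hyperfilter ℕ)) (by
      rw [Filter.le_principal_iff, Ultrafilter.coe_map, Filter.mem_map]
      apply Filter.univ_mem'
      intro n
      simpa [f] using hM n)
  have hlim : ∀ y, Tendsto (fun n => a n y) (hyperfilter ℕ : Filter ℕ)
      (𝓝 (WeakDual.toStrongDual b y)) := by
    intro y
    exact ((WeakDual.eval_continuous y).tendsto b).comp hb
  have ht' : Tendsto t (hyperfilter ℕ : Filter ℕ) (𝓝 t0) := ht.mono_left Nat.hyperfilter_le_atTop
  refine ⟨WeakDual.toStrongDual b, max_mem' hA fun y ys hy => ?_⟩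
  have h1 : Tendsto (fun n => t n * a n w - a n y - t n * ys w + ys y) (hyperfilter ℕ : Filter ℕ)
      (𝓝 (t0 * WeakDual.toStrongDual b w - WeakDual.toStrongDual b y - t0 * ys w + ys y)) :=
    (((ht'.mul (hlim w)).sub (hlim y)).sub (ht'.mul tendsto_const_nhds)).add tendsto_const_nhds
  simp only [map_smul, smul_eq_mul]
  apply ge_of_tendsto' h1
  intro n
  have := mono_ineq hA.1 (ha n) hy
  simpa only [map_smul, smul_eq_mul] using this

theorem normal_vec {A : Set (X × (X →L[ℝ] ℝ))} (hA : IsMaxMonotoneOp A) {w c : X}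
    {a : X →L[ℝ] ℝ} (hc : (c, a) ∈ A) (hc' : c ∉ interior (convexHull ℝ (opDom A)))
    (hw : w ∈ interior (convexHull ℝ (opDom A))) :
    ∃ f : X →L[ℝ] ℝ, f w < f c ∧ ∀ s : ℝ, 0 ≤ s → (c, a + s • f) ∈ A := by
  have hconv := convex_convexHull ℝ (opDom A)
  obtain ⟨f, hf⟩ := geometric_hahn_banach_open_point hconv.interior isOpen_interior hc'
  refine ⟨f, hf w hw, fun s hs => max_mem' hA fun y ys hy => ?_⟩
  have h1 : y ∈ closure (interior (convexHull ℝ (opDom A))) := by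
    rw [hconv.closure_interior_eq_closure_of_nonempty_interior ⟨w, hw⟩]
    exact subset_closure (subset_convexHull ℝ _ ⟨ys, hy⟩)
  have h2 : closure (interior (convexHull ℝ (opDom A))) ⊆ {d | f d ≤ f c} :=
    closure_minimal (fun d hd => (hf d hd).le) (isClosed_le f.continuous continuous_const)
  have h3 : f y ≤ f c := h2 h1
  have h4 := mono_ineq hA.1 hc hy
  have h5 := mul_le_mul_of_nonneg_left h3 hs
  simp only [_root_.add_apply, _root_.smul_apply, smul_eq_mul]
  linarith

theorem segment_mem [CompleteSpace X] {G H : Set (X × (X →L[ℝ] ℝ))} (hG : IsMaxMonotoneOp G)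
    (hH : IsMaxMonotoneOp H) (hGn : (interior (opDom G)).Nonempty)
    (hHn : (interior (opDom H)).Nonempty)
    (hrel : ∀ x a b, (x, a) ∈ G → (x, b) ∈ H → 0 ≤ a x + b x) {w : X}
    (hw : w ∈ interior (convexHull ℝ (opDom G)) ∩ interior (convexHull ℝ (opDom H)))
    {t : ℝ} (ht0 : 0 < t) (ht1 : t ≤ 1) :
    t • w ∈ interior (convexHull ℝ (opDom G)) ∩ interior (convexHull ℝ (opDom H)) := by
  set C := interior (convexHull ℝ (opDom G)) ∩ interior (convexHull ℝ (opDom H)) with hC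
  have hCopen : IsOpen C := isOpen_interior.inter isOpen_interior
  have hGs := conv_int_subset hG hGn
  have hHs := conv_int_subset hH hHn
  by_contra hnot
  let T : Set ℝ := Icc 0 1 ∩ (fun t : ℝ => t • w) ⁻¹' Cᶜ
  have hTc : IsCompact T := by
    apply isCompact_Icc.inter_right
    exact hCopen.isClosed_compl.preimage (by fun_prop)
  obtain ⟨t0, ⟨⟨-, ht01⟩, ht0C⟩, hmax⟩ := hTc.exists_isGreatest ⟨t, ⟨ht0.le, ht1⟩, hnot⟩
  have htt0 : t ≤ t0 := hmax ⟨⟨ht0.le, ht1⟩, hnot⟩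
  have ht0pos : 0 < t0 := ht0.trans_le htt0
  have ht0lt : t0 < 1 := by
    rcases ht01.lt_or_eq with h | h
    · exact h
    · exfalso
      apply ht0C
      simpa [h] using hw
  have hin : ∀ s, t0 < s → s ≤ 1 → s • w ∈ C := by
    intro s hs hs1
    by_contra hsC
    have := hmax (a := s) ⟨⟨(ht0pos.trans hs).le, hs1⟩, hsC⟩
    linarith
  obtain ⟨a1, ha1⟩ := hGs hw.1
  obtain ⟨b1, hb1⟩ := hHs hw.2
  obtain ⟨τ, -, hτ, hτlim⟩ := exists_seq_strictAnti_tendsto' ht0lt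
  have hτ01 : ∀ n, τ n ∈ Ioo (0 : ℝ) 1 := fun n => ⟨ht0pos.trans (hτ n).1, (hτ n).2⟩
  choose a ha using fun n => hGs (hin (τ n) (hτ n).1 (hτ n).2.le).1
  choose b hb using fun n => hHs (hin (τ n) (hτ n).1 (hτ n).2.le).2
  have hsum : ∀ n, 0 ≤ a n w + b n w := by
    intro n
    have := hrel _ _ _ (ha n) (hb n)
    simp only [map_smul, smul_eq_mul, ← mul_add] at this
    exact nonneg_of_mul_nonneg_right this (hτ01 n).1
  have haup : ∀ n, a n w ≤ a1 w := by
    intro n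
    have := mono_ineq hG.1 ha1 (ha n)
    simp only [map_smul, smul_eq_mul] at this
    have h2 : 0 ≤ (1 - τ n) * (a1 w - a n w) := by linarith
    have := nonneg_of_mul_nonneg_right h2 (by linarith [(hτ01 n).2])
    linarith
  have hbup : ∀ n, b n w ≤ b1 w := by
    intro n
    have := mono_ineq hH.1 hb1 (hb n)
    simp only [map_smul, smul_eq_mul] at this
    have h2 : 0 ≤ (1 - τ n) * (b1 w - b n w) := by linarith
    have := nonneg_of_mul_nonneg_right h2 (by linarith [(hτ01 n).2])
    linarith
  have hwG : w ∈ interior (opDom G) := interior_maximal hGs isOpen_interior hw.1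
  have hwH : w ∈ interior (opDom H) := interior_maximal hHs isOpen_interior hw.2
  obtain ⟨a0, ha0⟩ := lim_dom hG hwG hτlim hτ01 ha (K := b1 w)
    (fun n => by linarith [hsum n, hbup n])
  obtain ⟨b0, hb0⟩ := lim_dom hH hwH hτlim hτ01 hb (K := a1 w)
    (fun n => by linarith [hsum n, haup n])
  -- conclude with a normal vector
  have key : ∀ (f : X →L[ℝ] ℝ), f w < f (t0 • w) →
      (∀ s : ℝ, 0 ≤ s → 0 ≤ a0 (t0 • w) + b0 (t0 • w) + s * f (t0 • w)) → False := by
    intro f hf hs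
    simp only [map_smul, smul_eq_mul] at hf hs
    have hfw : f w < 0 := by nlinarith
    have hneg : 0 < -(t0 * f w) := by nlinarith
    set q := t0 * a0 w + t0 * b0 w with hq
    have := hs ((|q| + 1) / (-(t0 * f w))) (by positivity)
    have e : (|q| + 1) / (-(t0 * f w)) * (t0 * f w) = -(|q| + 1) := by
      have : t0 * f w ≠ 0 := by linarith
      rw [div_neg, neg_mul, div_mul_cancel₀ _ this]
    rw [e] at this
    linarith [le_abs_self q]
  have hcases : t0 • w ∉ interior (convexHull ℝ (opDom G)) ∨
      t0 • w ∉ interior (convexHull ℝ (opDom H)) := by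
    by_contra hcon
    push Not at hcon
    exact ht0C hcon
  rcases hcases with h | h
  · obtain ⟨f, hf, hfs⟩ := normal_vec hG ha0 h hw.1
    refine key f hf fun s hs => ?_
    have := hrel _ _ _ (hfs s hs) hb0
    simp only [_root_.add_apply, _root_.smul_apply, smul_eq_mul] at this
    linarith
  · obtain ⟨f, hf, hfs⟩ := normal_vec hH hb0 h hw.2
    refine key f hf fun s hs => ?_
    have := hrel _ _ _ ha0 (hfs s hs)
    simp only [_root_.add_apply, _root_.smul_apply, smul_eq_mul] at this
    linarith

theorem le_of_forall_small {x k : ℝ} (h : ∀ t : ℝ, 0 < t → t < 1 → t * k ≤ x) : 0 ≤ x := by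
  have h1 : Tendsto (fun t : ℝ => t * k) (𝓝[>] 0) (𝓝 0) := by
    have : Continuous (fun t : ℝ => t * k) := by fun_prop
    have h2 := this.tendsto 0
    rw [zero_mul] at h2
    exact h2.mono_left nhdsWithin_le_nhds
  apply le_of_tendsto h1
  filter_upwards [Ioo_mem_nhdsGT (zero_lt_one' ℝ)] with t ht
  exact h t ht.1 ht.2

theorem core [CompleteSpace X] {G H : Set (X × (X →L[ℝ] ℝ))} (hG : IsMaxMonotoneOp G)
    (hH : IsMaxMonotoneOp H) {x : X} (hxG : x ∈ interior (opDom G)) (hxH : x ∈ interior (opDom H))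
    (hrel : ∀ x a b, (x, a) ∈ G → (x, b) ∈ H → 0 ≤ a x + b x) :
    ∃ g : X →L[ℝ] ℝ, ((0 : X), g) ∈ G ∧ ((0 : X), -g) ∈ H := by
  have hGs := conv_int_subset hG ⟨x, hxG⟩
  have hHs := conv_int_subset hH ⟨x, hxH⟩
  have hxC : x ∈ interior (convexHull ℝ (opDom G)) ∩ interior (convexHull ℝ (opDom H)) :=
    ⟨interior_mono (subset_convexHull ℝ _) hxG, interior_mono (subset_convexHull ℝ _) hxH⟩
  have hseg := fun {w : X} hw {t : ℝ} (h0 : 0 < t) h1 =>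
    segment_mem hG hH ⟨x, hxG⟩ ⟨x, hxH⟩ hrel (w := w) hw h0 h1
  obtain ⟨ax, hax⟩ := hGs hxC.1
  obtain ⟨bx, hbx⟩ := hHs hxC.2
  -- nonnegativity at interior points
  have hnn : ∀ p ∈ convexHull ℝ (epiOp G), ∀ q ∈ convexHull ℝ (epiOp H), p.1 = q.1 →
      p.1 ∈ interior (convexHull ℝ (opDom G)) ∩ interior (convexHull ℝ (opDom H)) →
      0 ≤ p.2 + q.2 := by
    intro p hp q hq hpq hpC
    obtain ⟨v, hv⟩ := epi_ineq hG.1 hp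
    obtain ⟨v', hv'⟩ := epi_ineq hH.1 hq
    apply le_of_forall_small (k := v p.1 + v' p.1)
    intro t ht0 ht1
    have hm := hseg hpC ht0 ht1.le
    obtain ⟨a, ha⟩ := hGs hm.1
    obtain ⟨b, hb⟩ := hHs hm.2
    have e1 := hv _ _ ha
    have e2 := hv' _ _ hb
    have e3 := hrel _ _ _ ha hb
    rw [← hpq] at e2
    simp only [map_smul, smul_eq_mul] at e1 e2 e3
    have e4 : 0 ≤ a p.1 + b p.1 := by
      rw [← mul_add] at e3
      exact nonneg_of_mul_nonneg_right e3 ht0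
    nlinarith
  have hnn' : ∀ p ∈ convexHull ℝ (epiOp G), ∀ q ∈ convexHull ℝ (epiOp H), p.1 = q.1 →
      0 ≤ p.2 + q.2 := by
    intro p hp q hq hpq
    have hpG : p.1 ∈ convexHull ℝ (opDom G) := by
      rw [← fst_epi]; exact ⟨p, hp, rfl⟩
    have hpH : p.1 ∈ convexHull ℝ (opDom H) := by
      rw [← fst_epi]; exact ⟨q, hq, hpq.symm⟩
    have hp0 : (x, ax x) ∈ convexHull ℝ (epiOp G) := subset_convexHull ℝ _ ⟨ax, hax, le_rfl⟩
    have hq0 : (x, bx x) ∈ convexHull ℝ (epiOp H) := subset_convexHull ℝ _ ⟨bx, hbx, le_rfl⟩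
    apply le_of_forall_small (k := p.2 + q.2 - (ax x + bx x))
    intro t ht0 ht1
    have := hnn _ (convex_convexHull ℝ _ hp hp0 (sub_nonneg.2 ht1.le) ht0.le (by ring))
      _ (convex_convexHull ℝ _ hq hq0 (sub_nonneg.2 ht1.le) ht0.le (by ring))
      (by simp [hpq])
      ⟨(convex_convexHull ℝ _).combo_self_interior_mem_interior hpG hxC.1
          (sub_nonneg.2 ht1.le) ht0 (by ring),
        (convex_convexHull ℝ _).combo_self_interior_mem_interior hpH hxC.2
          (sub_nonneg.2 ht1.le) ht0 (by ring)⟩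
    simp only [Prod.snd_add, Prod.smul_snd, smul_eq_mul] at this
    linarith
  let D : Set (X × ℝ) := {d | ∃ p ∈ convexHull ℝ (epiOp G), ∃ q ∈ convexHull ℝ (epiOp H),
    d = (p.1 - q.1, p.2 + q.2)}
  have hDconv : Convex ℝ D := by
    rintro d ⟨p, hp, q, hq, rfl⟩ d' ⟨p', hp', q', hq', rfl⟩ a b ha hb hab
    refine ⟨_, convex_convexHull ℝ _ hp hp' ha hb hab, _,
      convex_convexHull ℝ _ hq hq' ha hb hab, ?_⟩
    ext
    · simp only [Prod.fst_add, Prod.smul_fst, smul_sub]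
      abel
    · simp only [Prod.snd_add, Prod.smul_snd, smul_eq_mul]
      ring
  obtain ⟨ε, hε, M, hM⟩ := epi_open hG.1 hxG
  have hopen : ∀ u : X, ‖u - 0‖ < ε → ∀ s, M + bx x < s → (u, s) ∈ D := by
    intro u hu s hs
    refine ⟨(x + u, s - bx x), subset_convexHull ℝ _ (hM _ (by simpa using hu) _ (by linarith)),
      (x, bx x), subset_convexHull ℝ _ ⟨bx, hbx, le_rfl⟩, ?_⟩
    simp
  obtain ⟨g, hg⟩ := hb_lemma hDconv hε hopen (by
      rw [mem_interior_iff_mem_nhds, Metric.mem_nhds_iff]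
      refine ⟨ε, hε, fun u hu => ⟨(u, M + bx x + 1), hopen u ?_ _ (by linarith), rfl⟩⟩
      simpa [dist_eq_norm] using hu) (by
      rintro s ⟨p, hp, q, hq, h⟩
      rw [Prod.mk.injEq] at h
      rw [h.2]
      exact hnn' p hp q hq (sub_eq_zero.1 h.1.symm))
  have hg' : ∀ y ys z zs, (y, ys) ∈ G → (z, zs) ∈ H → g y - g z ≤ ys y + zs z := by
    intro y ys z zs hy hz
    have := hg (y - z) (ys y + zs z) ⟨(y, ys y), subset_convexHull ℝ _ ⟨ys, hy, le_rfl⟩,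
      (z, zs z), subset_convexHull ℝ _ ⟨zs, hz, le_rfl⟩, rfl⟩
    rwa [map_sub] at this
  refine ⟨g, max_mem' hG fun y ys hy => ?_, max_mem' hH fun y ys hy => ?_⟩
  · apply le_of_forall_small (k := -(g x + bx x))
    intro t ht0 ht1
    obtain ⟨b, hb⟩ := hHs (hseg hxC ht0 ht1.le).2
    have e1 := hg' _ _ _ _ hy hb
    have e2 := mono_ineq hH.1 hbx hb
    simp only [map_smul, smul_eq_mul, map_zero] at e1 e2 ⊢
    have h2 : 0 ≤ (1 - t) * (bx x - b x) := by linarith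
    have h3 := nonneg_of_mul_nonneg_right h2 (by linarith)
    have h4 := mul_nonneg ht0.le h3
    linarith
  · apply le_of_forall_small (k := g x - ax x)
    intro t ht0 ht1
    obtain ⟨a, ha⟩ := hGs (hseg hxC ht0 ht1.le).1
    have e1 := hg' _ _ _ _ ha hy
    have e2 := mono_ineq hG.1 hax ha
    simp only [map_smul, smul_eq_mul, map_zero, _root_.neg_apply] at e1 e2 ⊢
    have h2 : 0 ≤ (1 - t) * (ax x - a x) := by linarith
    have h3 := nonneg_of_mul_nonneg_right h2 (by linarith)
    have h4 := mul_nonneg ht0.le h3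
    linarith

/-- sum theorem under nonempty interior intersection. -/
theorem sum_theorem_interiors {X : Type*} [NormedAddCommGroup X] [NormedSpace ℝ X]
    [CompleteSpace X]
    (A B : Set (X × (X →L[ℝ] ℝ)))
    (hA : IsMaxMonotoneOp A) (hB : IsMaxMonotoneOp B)
    (hdom : (interior (opDom A) ∩ interior (opDom B)).Nonempty) :
    IsMaxMonotoneOp (opSum A B) := by
  have hsumM : IsMonotoneOp (opSum A B) := by
    rintro ⟨x, xs⟩ ⟨a, b, ha, hb, hx⟩ ⟨y, ys⟩ ⟨c, d, hc, hd, hy⟩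
    simp only at ha hb hx hc hd hy
    subst hx hy
    have e1 := mono_ineq hA.1 ha hc
    have e2 := mono_ineq hB.1 hb hd
    simp only [_root_.sub_apply, _root_.add_apply, map_sub]
    linarith
  refine ⟨hsumM, fun S hS hsub => subset_antisymm ?_ hsub⟩
  rintro ⟨z, zs⟩ hz
  obtain ⟨x, hxA, hxB⟩ := hdom
  obtain ⟨g, hgA, hgB⟩ := core (shift_max hA z 0) (shift_max hB z zs) (x := x - z)
    (by rw [shift_int]; simpa using hxA) (by rw [shift_int]; simpa using hxB) (by
      intro y a b ha hb
      have hmem : (y + z, (a + 0) + (b + zs)) ∈ opSum A B := ⟨_, _, ha, hb, rfl⟩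
      have := hS _ (hsub hmem) _ hz
      simp only [_root_.sub_apply, _root_.add_apply, map_sub, map_add, add_zero] at this
      linarith)
  refine ⟨g + 0, -g + zs, ?_, ?_, ?_⟩
  · simpa [shiftOp] using hgA
  · simpa [shiftOp] using hgB
  · simp
end
end

section
/- Let X be a real Banach space and let A : X ⇉ X* be a maximally monotone operator with int(dom A) ≠ ∅. Then A is of type (FPV). -/
open Set Filter Topology

noncomputable section

variable {X : Type*} [NormedAddCommGroup X] [NormedSpace ℝ X]

lemma aux_sum_nonneg {ι : Type} (t : Finset ι) (w : ι → ℝ) (y : ι → X) (f : ι → (X →L[ℝ] ℝ))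
    (z : X) (hw : ∀ i ∈ t, 0 ≤ w i) (h1 : ∑ i ∈ t, w i = 1) (hz : ∑ i ∈ t, w i • y i = z)
    (hm : ∀ i ∈ t, ∀ j ∈ t, 0 ≤ (f i - f j) (y i - y j)) :
    0 ≤ ∑ i ∈ t, w i * f i (y i - z) := by
  have e : ∀ i, w i * f i (y i - z) = ∑ j ∈ t, w i * w j * f i (y i - y j) := by
    intro i
    have : y i - z = ∑ j ∈ t, w j • (y i - y j) := by
      simp only [smul_sub, Finset.sum_sub_distrib, ← Finset.sum_smul, h1, hz, one_smul]
    rw [this, map_sum, Finset.mul_sum]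
    refine Finset.sum_congr rfl fun j _ => ?_
    rw [map_smul, smul_eq_mul, mul_assoc]
  simp only [e]
  have hs : ∑ i ∈ t, ∑ j ∈ t, w i * w j * f i (y i - y j)
      = ∑ i ∈ t, ∑ j ∈ t, w i * w j * f j (y j - y i) := by
    rw [Finset.sum_comm]
    refine Finset.sum_congr rfl fun j _ => Finset.sum_congr rfl fun i _ => ?_
    ring
  have h2 : 0 ≤ ∑ i ∈ t, ∑ j ∈ t, w i * w j * (f i - f j) (y i - y j) :=
    Finset.sum_nonneg fun i hi => Finset.sum_nonneg fun j hj =>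
      mul_nonneg (mul_nonneg (hw i hi) (hw j hj)) (hm i hi j hj)
  have h3 : ∑ i ∈ t, ∑ j ∈ t, w i * w j * (f i - f j) (y i - y j)
      = ∑ i ∈ t, ∑ j ∈ t, w i * w j * f i (y i - y j)
        + ∑ i ∈ t, ∑ j ∈ t, w i * w j * f j (y j - y i) := by
    rw [← Finset.sum_add_distrib]
    refine Finset.sum_congr rfl fun i _ => ?_
    rw [← Finset.sum_add_distrib]
    refine Finset.sum_congr rfl fun j _ => ?_
    simp only [ContinuousLinearMap.sub_apply, map_sub]
    ring
  linarith

/-- Points of the interior of the convex hull of the domain admit a related functional. -/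
lemma aux_extend (S : Set (X × (X →L[ℝ] ℝ))) (hS : IsMonotoneOp S) (z p : X) (r M : ℝ)
    (hr : 0 < r) (hb : ∀ y ∈ Metric.ball p r, ∃ ys, (y, ys) ∈ S ∧ ys (y - z) ≤ M)
    (hz : z ∈ interior (convexHull ℝ (opDom S))) :
    ∃ zs : X →L[ℝ] ℝ, MonotonicallyRelated S (z, zs) := by
  set E0 : Set (X × ℝ) := {e | ∃ ys, (e.1, ys) ∈ S ∧ ys (e.1 - z) ≤ e.2} with hE0
  set E := convexHull ℝ E0 with hE
  have hEc : Convex ℝ E := convex_convexHull ℝ E0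
  have hsub : Metric.ball p r ×ˢ Ioi M ⊆ interior E := by
    refine interior_maximal ?_ (Metric.isOpen_ball.prod isOpen_Ioi)
    rintro ⟨y, t⟩ ⟨hy, ht⟩
    obtain ⟨ys, h1, h2⟩ := hb y hy
    exact subset_convexHull ℝ E0 ⟨ys, h1, h2.trans (le_of_lt ht)⟩
  have hpos : ∀ e ∈ E, e.1 = z → 0 ≤ e.2 := by
    intro e he hez
    rw [hE, convexHull_eq] at he
    obtain ⟨ι, t, w, q, hw, h1, hq, hc⟩ := he
    rw [Finset.centerMass_eq_of_sum_1 _ _ h1] at hc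
    have hq' : ∀ i, ∃ ys : X →L[ℝ] ℝ, i ∈ t → ((q i).1, ys) ∈ S ∧ ys ((q i).1 - z) ≤ (q i).2 := by
      intro i
      by_cases hi : i ∈ t
      · obtain ⟨ys, h⟩ := hq i hi
        exact ⟨ys, fun _ => h⟩
      · exact ⟨0, fun h => absurd h hi⟩
    choose f hf using hq'
    have e1 : ∑ i ∈ t, w i • (q i).1 = z := by
      rw [← hez, ← hc, Prod.fst_sum]; rfl
    have e2 : ∑ i ∈ t, w i * (q i).2 = e.2 := by
      rw [← hc, Prod.snd_sum]; rfl
    have := aux_sum_nonneg t w (fun i => (q i).1) f z hw h1 e1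
      (fun i hi j hj => hS _ (hf i hi).1 _ (hf j hj).1)
    rw [← e2]
    exact this.trans (Finset.sum_le_sum fun i hi =>
      mul_le_mul_of_nonneg_left (hf i hi).2 (hw i hi))
  have hnot : ((z, 0) : X × ℝ) ∉ interior E := by
    intro h
    have hc : Tendsto (fun s : ℝ => ((z, s) : X × ℝ)) (𝓝[<] 0) (𝓝 (z, 0)) := by
      have : Continuous (fun s : ℝ => ((z, s) : X × ℝ)) := by fun_prop
      exact (this.tendsto 0).mono_left nhdsWithin_le_nhds
    have h1 := hc.eventually (mem_interior_iff_mem_nhds.1 h)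
    obtain ⟨s, hs1, hs2⟩ := (h1.and self_mem_nhdsWithin).exists
    have := hpos _ hs1 rfl
    exact absurd this (not_le.2 hs2)
  obtain ⟨F, hF⟩ := geometric_hahn_banach_open_point hEc.interior isOpen_interior hnot
  have hne : (interior E).Nonempty :=
    ⟨(p, M + 1), hsub ⟨Metric.mem_ball_self hr, by simp⟩⟩
  have hFE : ∀ e ∈ E, F e ≤ F (z, 0) := by
    intro e he
    have h1 : e ∈ closure (interior E) := by
      rw [hEc.closure_interior_eq_closure_of_nonempty_interior hne]
      exact subset_closure he
    exact closure_minimal (fun e he => (hF e he).le)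
      (isClosed_le F.continuous continuous_const) h1
  set g : X →L[ℝ] ℝ := F.comp (ContinuousLinearMap.inl ℝ X ℝ) with hg
  set α : ℝ := F (0, 1) with hα
  have hdec : ∀ u : X, ∀ t : ℝ, F (u, t) = g u + t * α := by
    intro u t
    have : ((u, t) : X × ℝ) = (u, 0) + t • (0, 1) := by simp
    rw [this, map_add, map_smul]; rfl
  have hlt : ∀ t > M, g p + t * α < g z := by
    intro t ht
    have := hF (p, t) (hsub ⟨Metric.mem_ball_self hr, ht⟩)
    rw [hdec, hdec] at this
    simpa using this
  have hα0 : α ≤ 0 := by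
    by_contra! h
    have h1 := hlt (max (M + 1) ((g z - g p) / α)) (lt_of_lt_of_le (by linarith) (le_max_left _ _))
    have h2 : (g z - g p) / α * α ≤ max (M + 1) ((g z - g p) / α) * α :=
      mul_le_mul_of_nonneg_right (le_max_right _ _) h.le
    rw [div_mul_cancel₀ _ h.ne'] at h2
    linarith
  have hSg : ∀ y ys, (y, ys) ∈ S → g y + ys (y - z) * α ≤ g z := by
    intro y ys h
    have := hFE (y, ys (y - z)) (subset_convexHull ℝ E0 ⟨ys, h, le_rfl⟩)
    rw [hdec, hdec] at this
    simpa using this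
  have hαlt : α < 0 := by
    refine lt_of_le_of_ne hα0 fun h0 => ?_
    have h1 : g p < g z := by simpa [h0] using hlt (M + 1) (by linarith)
    have h2 : convexHull ℝ (opDom S) ⊆ {y | g y ≤ g z} := by
      refine convexHull_min ?_ (convex_halfSpace_le g.toLinearMap.isLinear _)
      rintro y ⟨ys, hy⟩
      simpa [h0] using hSg y ys hy
    have hc : Tendsto (fun s : ℝ => z + s • (z - p)) (𝓝[>] 0) (𝓝 z) := by
      have : Continuous (fun s : ℝ => z + s • (z - p)) := by fun_prop
      have := this.tendsto 0
      simp only [zero_smul, add_zero] at this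
      exact this.mono_left nhdsWithin_le_nhds
    obtain ⟨s, hs1, hs2⟩ :=
      ((hc.eventually (mem_interior_iff_mem_nhds.1 hz)).and self_mem_nhdsWithin).exists
    have h3 : g (z + s • (z - p)) ≤ g z := h2 hs1
    simp only [map_add, map_smul, map_sub, smul_eq_mul] at h3
    have : 0 < s * (g z - g p) := mul_pos hs2 (by linarith)
    linarith
  refine ⟨(-α⁻¹) • g, ?_⟩
  rintro ⟨y, ys⟩ hy
  have h := hSg y ys hy
  simp only [ContinuousLinearMap.sub_apply, ContinuousLinearMap.smul_apply, smul_eq_mul, map_sub]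
  rw [map_sub] at h
  have h5 : 0 ≤ (g z - g y - (ys y - ys z) * α) * (-α⁻¹) :=
    mul_nonneg (by linarith) (by have := inv_lt_zero.2 hαlt; linarith)
  have h6 : (g z - g y - (ys y - ys z) * α) * (-α⁻¹)
      = -α⁻¹ * (g z - g y) + (ys y - ys z) := by
    have hi : α * α⁻¹ = 1 := mul_inv_cancel₀ hαlt.ne
    linear_combination (ys y - ys z) * hi
  linarith

/-- Local boundedness somewhere in every nonempty open subset of the domain. -/
lemma aux_locbdd [CompleteSpace X] (A : Set (X × (X →L[ℝ] ℝ))) (hA : IsMonotoneOp A)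
    (W : Set X) (hW : IsOpen W) (hne : W.Nonempty) (hWA : W ⊆ opDom A) :
    ∃ p ∈ W, ∃ r > 0, Metric.ball p r ⊆ W ∧ ∀ z, ∃ M : ℝ, ∀ y ∈ Metric.ball p r, ∀ ys,
      (y, ys) ∈ A → ys (y - z) ≤ M := by
  set C : ℕ → Set X := fun n => {z | ∀ q ∈ A, q.2 (z - q.1) ≤ n * (1 + ‖q.1‖)} with hC
  have hCc : ∀ n, IsClosed (C n) := by
    intro n
    have : C n = ⋂ q ∈ A, {z | q.2 (z - q.1) ≤ n * (1 + ‖q.1‖)} := by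
      ext z; simp [hC]
    rw [this]
    refine isClosed_biInter fun q _ => isClosed_le ?_ continuous_const
    fun_prop
  have hcov : ⋃ n, (C n ∪ Wᶜ) = univ := by
    refine eq_univ_of_forall fun z => ?_
    by_cases hz : z ∈ W
    · obtain ⟨zs, hzs⟩ := hWA hz
      obtain ⟨n, hn⟩ := exists_nat_ge (‖zs‖ * (‖z‖ + 1))
      refine mem_iUnion.2 ⟨n, Or.inl fun q hq => ?_⟩
      have h1 := hA _ hzs _ hq
      simp only [ContinuousLinearMap.sub_apply] at h1
      have h2 : zs (z - q.1) ≤ ‖zs‖ * ‖z - q.1‖ := (le_abs_self _).trans (zs.le_opNorm _)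
      have h3 : ‖z - q.1‖ ≤ ‖z‖ + ‖q.1‖ := norm_sub_le _ _
      have h4 : ‖z‖ + ‖q.1‖ ≤ (‖z‖ + 1) * (1 + ‖q.1‖) := by
        nlinarith [norm_nonneg z, norm_nonneg q.1, mul_nonneg (norm_nonneg z) (norm_nonneg q.1)]
      calc q.2 (z - q.1) ≤ ‖zs‖ * ‖z - q.1‖ := by linarith
        _ ≤ ‖zs‖ * ((‖z‖ + 1) * (1 + ‖q.1‖)) :=
            mul_le_mul_of_nonneg_left (h3.trans h4) (norm_nonneg _)
        _ = ‖zs‖ * (‖z‖ + 1) * (1 + ‖q.1‖) := by ring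
        _ ≤ n * (1 + ‖q.1‖) := mul_le_mul_of_nonneg_right hn (by positivity)
    · exact mem_iUnion.2 ⟨0, Or.inr hz⟩
  have hd := dense_iUnion_interior_of_closed
    (fun n => (hCc n).union hW.isClosed_compl) hcov
  obtain ⟨p, hpW, hp⟩ := hd.inter_open_nonempty W hW hne
  obtain ⟨n, hn⟩ := mem_iUnion.1 hp
  have ho : IsOpen (interior (C n ∪ Wᶜ) ∩ W) := isOpen_interior.inter hW
  obtain ⟨ε, hε, hball⟩ := Metric.isOpen_iff.1 ho p ⟨hn, hpW⟩
  have hbC : Metric.ball p ε ⊆ C n := by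
    intro y hy
    have := hball hy
    rcases interior_subset this.1 with h | h
    · exact h
    · exact absurd this.2 h
  refine ⟨p, hpW, ε / 2, by positivity, fun y hy => (hball (Metric.ball_subset_ball (by linarith) hy)).2, ?_⟩
  intro z
  set R : ℝ := ε / 2 + ‖p - z‖ with hR
  have hRp : 0 < R := by positivity
  refine ⟨R / (ε / 2) * (n * (1 + (‖p‖ + ε / 2))), fun y hy ys hys => ?_⟩
  rw [Metric.mem_ball, dist_eq_norm] at hy
  have hyz : ‖y - z‖ < R := by
    have : y - z = (y - p) + (p - z) := by abel
    rw [this]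
    exact (norm_add_le _ _).trans_lt (by linarith)
  have hyn : ‖y‖ ≤ ‖p‖ + ε / 2 := by
    have : y = p + (y - p) := by abel
    rw [this]
    exact (norm_add_le _ _).trans (by linarith)
  set v : X := (ε / 2 / R) • (y - z) with hv
  have hvn : ‖v‖ < ε / 2 := by
    rw [hv, norm_smul, Real.norm_of_nonneg (by positivity), div_mul_eq_mul_div, div_lt_iff₀ hRp]
    exact mul_lt_mul_of_pos_left hyz (by positivity)
  have hmem : y + v ∈ Metric.ball p ε := by
    rw [Metric.mem_ball, dist_eq_norm]
    have : y + v - p = (y - p) + v := by abel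
    rw [this]
    exact (norm_add_le _ _).trans_lt (by linarith)
  have h1 := hbC hmem (y, ys) hys
  simp only [add_sub_cancel_left] at h1
  have h2 : ys (y - z) = R / (ε / 2) * ys v := by
    rw [hv, map_smul, smul_eq_mul]
    field_simp
  rw [h2]
  refine mul_le_mul_of_nonneg_left (h1.trans ?_) (by positivity)
  exact mul_le_mul_of_nonneg_left (by linarith) (by positivity)

lemma aux_max (A : Set (X × (X →L[ℝ] ℝ))) (hA : IsMaxMonotoneOp A) (q : X × (X →L[ℝ] ℝ))
    (hq : MonotonicallyRelated A q) : q ∈ A := by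
  have hm : IsMonotoneOp (insert q A) := by
    rintro a (rfl | ha) b (rfl | hb)
    · simp
    · exact hq b hb
    · have := hq a ha
      simp only [ContinuousLinearMap.sub_apply, map_sub] at this ⊢
      linarith
    · exact hA.1 a ha b hb
  rw [← hA.2 _ hm (subset_insert q A)]
  exact mem_insert q A

/-- Points in the closure of the domain that are related to the localized operator. -/
lemma aux_closure (A : Set (X × (X →L[ℝ] ℝ))) (hA : IsMaxMonotoneOp A) (K : Set X)
    (hK : Convex ℝ K) (hne : (interior K).Nonempty)
    (hKA : interior K ⊆ opDom A) (hAK : opDom A ⊆ K) (U : Set X) (hU : IsOpen U)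
    (x : X) (xs : X →L[ℝ] ℝ) (hxU : x ∈ U) (hxK : x ∈ closure K)
    (hx : MonotonicallyRelated (A ∩ (U ×ˢ (univ : Set (X →L[ℝ] ℝ)))) (x, xs)) :
    (x, xs) ∈ A := by
  have step1 : ∀ y ∈ interior K, ∀ ys, (y, ys) ∈ A → 0 ≤ (xs - ys) (x - y) := by
    intro y hy ys hys
    have hc : Tendsto (fun s : ℝ => x + s • (y - x)) (𝓝[>] 0) (𝓝 x) := by
      have : Continuous (fun s : ℝ => x + s • (y - x)) := by fun_prop
      have := this.tendsto 0
      simp only [zero_smul, add_zero] at this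
      exact this.mono_left nhdsWithin_le_nhds
    obtain ⟨s, hsU, hs0, hs1⟩ := ((hc.eventually (hU.mem_nhds hxU)).and
      (Ioo_mem_nhdsGT (zero_lt_one' ℝ))).exists
    obtain ⟨ws, hws⟩ := hKA (hK.add_smul_sub_mem_interior' hxK hy ⟨hs0, hs1.le⟩)
    have h1 := hx _ ⟨hws, hsU, mem_univ _⟩
    have h2 := hA.1 _ hys _ hws
    simp only [ContinuousLinearMap.sub_apply, map_sub, map_add, map_smul, smul_eq_mul] at h1 h2 ⊢
    have h1' : 0 ≤ s * ((ws y - ws x) - (xs y - xs x)) := by linarith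
    have h2' : 0 ≤ (1 - s) * ((ys y - ys x) - (ws y - ws x)) := by linarith
    have h1'' := nonneg_of_mul_nonneg_right h1' hs0
    have h2'' := nonneg_of_mul_nonneg_right h2' (by linarith)
    linarith
  apply aux_max A hA
  rintro ⟨y, ys⟩ hy
  obtain ⟨d, hd⟩ := hne
  obtain ⟨ds, hds⟩ := hKA hd
  set m : X := (1 / 2 : ℝ) • x + (1 / 2 : ℝ) • y with hm
  have hmK : m ∈ closure K :=
    hK.closure hxK (subset_closure (hAK ⟨ys, hy⟩)) (by norm_num) (by norm_num) (by norm_num)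
  have key : ∀ s ∈ Ioo (0 : ℝ) 1,
      0 ≤ (xs - ys) (x - y) / 2 + s * ((xs + ys) (m - d) - 2 * ds (m - d)) := by
    rintro s ⟨hs0, hs1⟩
    have hzi := hK.add_smul_sub_mem_interior' hmK hd ⟨hs0, hs1.le⟩
    obtain ⟨zs, hzs⟩ := hKA hzi
    have h1 := step1 _ hzi _ hzs
    have h2 := hA.1 _ hy _ hzs
    have h3 := hA.1 _ hzs _ hds
    have e1 : x - (m + s • (d - m)) = (1 / 2 : ℝ) • (x - y) + s • (m - d) := by
      rw [hm]; module
    have e2 : y - (m + s • (d - m)) = -((1 / 2 : ℝ) • (x - y)) + s • (m - d) := by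
      rw [hm]; module
    have e3 : (m + s • (d - m)) - d = (1 - s) • (m - d) := by module
    simp only [e1, e2, e3] at h1 h2 h3
    generalize m - d = u at *
    generalize x - y = v at *
    simp only [ContinuousLinearMap.sub_apply, ContinuousLinearMap.add_apply, map_add, map_neg,
      map_smul, smul_eq_mul] at h1 h2 h3 ⊢
    have h3' : 0 ≤ (1 - s) * (zs u - ds u) := by linarith
    have h3'' := nonneg_of_mul_nonneg_right h3' (by linarith)
    have := mul_nonneg hs0.le h3''
    linarith
  have hc : Tendsto (fun s : ℝ => (xs - ys) (x - y) / 2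
      + s * ((xs + ys) (m - d) - 2 * ds (m - d))) (𝓝[>] 0) (𝓝 ((xs - ys) (x - y) / 2)) := by
    have : Continuous (fun s : ℝ => (xs - ys) (x - y) / 2
      + s * ((xs + ys) (m - d) - 2 * ds (m - d))) := by fun_prop
    have := this.tendsto 0
    simp only [zero_mul, add_zero] at this
    exact this.mono_left nhdsWithin_le_nhds
  have := ge_of_tendsto hc
    (Filter.mem_of_superset (Ioo_mem_nhdsGT (zero_lt_one' ℝ)) key)
  show 0 ≤ (xs - ys) (x - y)
  linarith

/-- a maximally monotone operator with nonempty domain interior is of type (FPV). -/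
theorem fpv_of_interior_nonempty {X : Type*} [NormedAddCommGroup X] [NormedSpace ℝ X]
    [CompleteSpace X]
    (A : Set (X × (X →L[ℝ] ℝ)))
    (hA : IsMaxMonotoneOp A)
    (hint : (interior (opDom A)).Nonempty) :
    IsFPV A := by
  refine ⟨hA, fun U hU hUc hUA x xs hxU hx => ?_⟩
  set K : Set X := convexHull ℝ (opDom A) with hKdef
  have hK : Convex ℝ K := convex_convexHull ℝ _
  have hAK : opDom A ⊆ K := subset_convexHull ℝ _
  have hne : (interior K).Nonempty := hint.mono (interior_mono hAK)
  have hKA : interior K ⊆ opDom A := by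
    intro z hz
    obtain ⟨p, -, r, hr, hsub, hM⟩ :=
      aux_locbdd A hA.1 (interior (opDom A)) isOpen_interior hint interior_subset
    obtain ⟨M, hM⟩ := hM z
    obtain ⟨zs, hzs⟩ := aux_extend A hA.1 z p r M hr (fun y hy => by
      obtain ⟨ys, hys⟩ := interior_subset (hsub hy)
      exact ⟨ys, hys, hM y hy ys hys⟩) hz
    exact ⟨zs, aux_max A hA _ hzs⟩
  by_cases hxK : x ∈ closure K
  · exact aux_closure A hA K hK hne hKA hAK U hU x xs hxU hxK hx
  exfalso
  have hcl : closure (interior K) = closure K :=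
    hK.closure_interior_eq_closure_of_nonempty_interior hne
  have hW : (U ∩ interior K).Nonempty := by
    obtain ⟨a, haU, haA⟩ := hUA
    have : a ∈ closure (interior K) := by
      rw [hcl]; exact subset_closure (hAK haA)
    exact mem_closure_iff.1 this U hU haU
  obtain ⟨d, ⟨hdU, hdK⟩, r, hr, hsub, hM⟩ :=
    aux_locbdd A hA.1 (U ∩ interior K) (hU.inter isOpen_interior) hW
      (inter_subset_right.trans hKA)
  -- the first point of the closure of `K` on the segment from `x` to `d`
  have hγ : Continuous (fun s : ℝ => x + s • (d - x)) := by fun_prop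
  have hTc : IsCompact (Icc (0 : ℝ) 1 ∩ (fun s : ℝ => x + s • (d - x)) ⁻¹' closure K) :=
    isCompact_Icc.inter_right (isClosed_closure.preimage hγ)
  obtain ⟨t, ⟨⟨ht0, ht1⟩, htK⟩, htmin⟩ := hTc.exists_isLeast
    ⟨1, ⟨zero_le_one, le_rfl⟩, by simpa using subset_closure (interior_subset hdK)⟩
  have ht0' : 0 < t := by
    refine lt_of_le_of_ne ht0 fun h => hxK ?_
    have : x + t • (d - x) ∈ closure K := htK
    rw [← h] at this
    simpa using this
  set b : X := x + t • (d - x) with hb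
  have hbK : b ∈ closure K := htK
  have hbint : b ∉ interior K := by
    intro h
    have hc : Tendsto (fun s : ℝ => x + s • (d - x)) (𝓝[<] t) (𝓝 b) :=
      (hγ.tendsto t).mono_left nhdsWithin_le_nhds
    obtain ⟨s, hsK, hs0, hst⟩ := ((hc.eventually (mem_interior_iff_mem_nhds.1 h)).and
      (Ioo_mem_nhdsLT ht0')).exists
    exact absurd (htmin ⟨⟨hs0.le, hst.le.trans ht1⟩, subset_closure hsK⟩) (not_le.2 hst)
  have hbU : b ∈ U := by
    have := hUc hxU hdU (a := 1 - t) (b := t) (by linarith) ht0 (by ring)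
    have e : b = (1 - t) • x + t • d := by rw [hb]; module
    rwa [e]
  -- a functional at `b`
  set B : Set (X × (X →L[ℝ] ℝ)) :=
    insert (x, xs) (A ∩ (U ×ˢ (univ : Set (X →L[ℝ] ℝ)))) with hB
  have hBm : IsMonotoneOp B := by
    rintro a (rfl | ha) c (rfl | hc)
    · simp
    · exact hx c hc
    · have := hx a ha
      simp only [ContinuousLinearMap.sub_apply, map_sub] at this ⊢
      linarith
    · exact hA.1 a ha.1 c hc.1
  have hbB : b ∈ interior (convexHull ℝ (opDom B)) := by
    refine (convex_convexHull ℝ (opDom B)).add_smul_sub_mem_interior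
      (subset_convexHull ℝ _ ⟨xs, mem_insert _ _⟩) ?_ ⟨ht0', ht1⟩
    refine interior_maximal ?_ Metric.isOpen_ball (Metric.mem_ball_self hr)
    intro y hy
    obtain ⟨ys, hys⟩ := hKA (hsub hy).2
    exact subset_convexHull ℝ _ ⟨ys, Or.inr ⟨hys, (hsub hy).1, mem_univ _⟩⟩
  obtain ⟨M, hM⟩ := hM b
  obtain ⟨bs, hbs⟩ := aux_extend B hBm b d r M hr (fun y hy => by
    obtain ⟨ys, hys⟩ := hKA (hsub hy).2
    exact ⟨ys, Or.inr ⟨hys, (hsub hy).1, mem_univ _⟩, hM y hy ys hys⟩) hbB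
  have hbA : (b, bs) ∈ A :=
    aux_closure A hA K hK hne hKA hAK U hU b bs hbU hbK (fun q hq => hbs q (Or.inr hq))
  obtain ⟨n, hn⟩ := geometric_hahn_banach_open_point hK.interior isOpen_interior hbint
  have hnK : ∀ y ∈ K, n y ≤ n b := by
    intro y hy
    have h1 : y ∈ closure (interior K) := by
      rw [hcl]; exact subset_closure hy
    exact closure_minimal (fun e he => (hn e he).le)
      (isClosed_le n.continuous continuous_const) h1
  have hray : ∀ l : ℝ, 0 ≤ l → (b, bs + l • n) ∈ A := by
    intro l hl
    apply aux_max A hA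
    rintro ⟨y, ys⟩ hy
    have h1 := hA.1 _ hbA _ hy
    have h2 := mul_nonneg hl (sub_nonneg.2 (hnK y (hAK ⟨ys, hy⟩)))
    simp only [ContinuousLinearMap.sub_apply, ContinuousLinearMap.add_apply,
      ContinuousLinearMap.smul_apply, map_sub, smul_eq_mul] at h1 ⊢
    linarith
  have hnd : n d < n b := hn d hdK
  have hnb : n b = n x + t * (n d - n x) := by
    rw [hb]; simp
  have hnx : n b < n x := by
    by_contra! h
    have h1 : 0 ≤ t * (n d - n x) := by linarith
    have h2 := nonneg_of_mul_nonneg_right h1 ht0'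
    nlinarith
  have hfin : ∀ l : ℝ, 0 ≤ l → l * (n x - n b) ≤ (xs - bs) (x - b) := by
    intro l hl
    have h1 := hx _ ⟨hray l hl, hbU, mem_univ _⟩
    simp only [ContinuousLinearMap.sub_apply, ContinuousLinearMap.add_apply,
      ContinuousLinearMap.smul_apply, map_sub, smul_eq_mul] at h1 ⊢
    linarith
  have hc0 := hfin 0 le_rfl
  have hpos : 0 < n x - n b := by linarith
  have := hfin (((xs - bs) (x - b) + 1) / (n x - n b)) (div_nonneg (by linarith) hpos.le)
  rw [div_mul_cancel₀ _ hpos.ne'] at this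
  linarith
end
end
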